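/- arXiv:quant-ph/0610199 — 3 statements merged into one kernel-verified Lean document; each statement's English description precedes it below -/
import Mathlib

section
/- Let A and B be Hermitian d×d complex matrices, and let T be a completely positive trace-preserving map given in Kraus form, T(X) = ∑_k K_k X K_k† where the K_k are d'×d complex matrices (finitely many) satisfying ∑_k K_k† K_k = I_d. Then Tr[{T(A) − T(B) ≥ 0}(T(A) − T(B))] ≤ Tr[{A − B ≥ 0}(A − B)]; equivalently, the trace of the positive part of T(A) − T(B) = T(A − B) is at most the trace of the positive part of A − B. -/
open Matrix Kronecker ComplexOrder

noncomputable section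

/-- Spectral projection `{C ≥ 0}` onto the span of eigenvectors with nonnegative
eigenvalues of a Hermitian matrix `C` (junk value `0` if `C` is not Hermitian). -/
def specProjNonneg {n : Type*} [Fintype n] [DecidableEq n] (C : Matrix n n ℂ) :
    Matrix n n ℂ :=
  if h : C.IsHermitian then
    (h.eigenvectorUnitary : Matrix n n ℂ) *
      Matrix.diagonal (fun i => if 0 ≤ h.eigenvalues i then (1 : ℂ) else 0) *
      star (h.eigenvectorUnitary : Matrix n n ℂ)
  else 0

/-- Trace of the positive part `C⁺` of a Hermitian matrix `C`, i.e. the sum of its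
nonnegative eigenvalues (junk value `0` if `C` is not Hermitian). -/
def posPartTrace {n : Type*} [Fintype n] [DecidableEq n] (C : Matrix n n ℂ) : ℝ :=
  if h : C.IsHermitian then ∑ i, max (h.eigenvalues i) 0 else 0

/-- `⟨ψ| X |ψ⟩`, conjugate-linear in the first argument. -/
def overlap {n : Type*} [Fintype n] (ψ : n → ℂ) (X : Matrix n n ℂ) : ℂ :=
  star ψ ⬝ᵥ X *ᵥ ψ

/-- `⟨φ| X |ψ⟩`, conjugate-linear in the first argument. -/
def sandwich {n : Type*} [Fintype n] (φ : n → ℂ) (X : Matrix n n ℂ) (ψ : n → ℂ) : ℂ :=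
  star φ ⬝ᵥ X *ᵥ ψ

/-- The maximally entangled state `|Ψ⁺_M⟩ = (1/√M) ∑_{i<M} e_i ⊗ e_i` in `ℂ^dA ⊗ ℂ^dB`. -/
def maxEnt (dA dB M : ℕ) : Fin dA × Fin dB → ℂ :=
  fun p => if (p.1 : ℕ) = (p.2 : ℕ) ∧ (p.1 : ℕ) < M then ((Real.sqrt M : ℂ))⁻¹ else 0

theorem re_trace_mul_eq_sum {n : Type*} [Fintype n] [DecidableEq n] {C : Matrix n n ℂ}
    (hC : C.IsHermitian) (Q : Matrix n n ℂ) :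
    (Q * C).trace.re =
      ∑ i, ((star (hC.eigenvectorUnitary : Matrix n n ℂ) * Q * hC.eigenvectorUnitary) i i).re *
        hC.eigenvalues i := by
  have h : (Q * C).trace =
      (star (hC.eigenvectorUnitary : Matrix n n ℂ) * Q * hC.eigenvectorUnitary *
        diagonal (fun i => (hC.eigenvalues i : ℂ))).trace := by
    conv_lhs => rw [hC.spectral_theorem, Unitary.conjStarAlgAut_apply]
    rw [← mul_assoc, ← mul_assoc, trace_mul_comm, ← mul_assoc, ← mul_assoc]
    rfl
  rw [h, trace, Complex.re_sum]
  simp [mul_diagonal]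

theorem posSemidef_specProjNonneg {n : Type*} [Fintype n] [DecidableEq n] (C : Matrix n n ℂ) :
    (specProjNonneg C).PosSemidef := by
  unfold specProjNonneg
  split_ifs with h
  · refine PosSemidef.mul_mul_conjTranspose_same (.diagonal fun i => ?_) _
    dsimp only
    split_ifs <;> simp
  · exact .zero

theorem posSemidef_one_sub_specProjNonneg {n : Type*} [Fintype n] [DecidableEq n]
    (C : Matrix n n ℂ) : (1 - specProjNonneg C).PosSemidef := by
  unfold specProjNonneg
  split_ifs with h
  · have h1 : (1 : Matrix n n ℂ) = (h.eigenvectorUnitary : Matrix n n ℂ) * diagonal (fun _ => 1) *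
        star (h.eigenvectorUnitary : Matrix n n ℂ) := by simp
    rw [h1, ← sub_mul, ← mul_sub, diagonal_sub]
    refine PosSemidef.mul_mul_conjTranspose_same (.diagonal fun i => ?_) _
    dsimp only
    split_ifs <;> simp
  · simpa using PosSemidef.one

theorem re_trace_specProjNonneg_mul {n : Type*} [Fintype n] [DecidableEq n] {C : Matrix n n ℂ}
    (hC : C.IsHermitian) : (specProjNonneg C * C).trace.re = posPartTrace C := by
  rw [re_trace_mul_eq_sum hC, posPartTrace, dif_pos hC, specProjNonneg, dif_pos hC]
  refine Finset.sum_congr rfl fun i _ => ?_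
  rw [mul_assoc, mul_assoc, mul_assoc, Unitary.coe_star_mul_self, mul_one, ← mul_assoc,
    Unitary.coe_star_mul_self, one_mul, diagonal_apply_eq]
  split_ifs with h
  · simp [h]
  · simp [le_of_not_ge h]

/-- The trace of the positive part dominates `Tr[Q C]` for every effect `0 ≤ Q ≤ 1`. -/
theorem re_trace_mul_le_posPartTrace {n : Type*} [Fintype n] [DecidableEq n]
    {C Q : Matrix n n ℂ} (hC : C.IsHermitian) (hQ : Q.PosSemidef) (hQ' : (1 - Q).PosSemidef) :
    (Q * C).trace.re ≤ posPartTrace C := by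
  rw [re_trace_mul_eq_sum hC, posPartTrace, dif_pos hC]
  refine Finset.sum_le_sum fun i _ => ?_
  have h0 := (Complex.le_def.1
    ((hQ.conjTranspose_mul_mul_same (hC.eigenvectorUnitary : Matrix n n ℂ)).diag_nonneg
      (i := i))).1
  have h1 := (Complex.le_def.1
    ((hQ'.conjTranspose_mul_mul_same (hC.eigenvectorUnitary : Matrix n n ℂ)).diag_nonneg
      (i := i))).1
  rw [← star_eq_conjTranspose] at h0 h1
  rw [mul_sub, sub_mul, mul_one, Unitary.coe_star_mul_self] at h1
  simp only [Matrix.sub_apply, one_apply_eq, Complex.sub_re, Complex.one_re, Complex.zero_re] at h0 h1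
  calc _ ≤ _ * max (hC.eigenvalues i) 0 := mul_le_mul_of_nonneg_left (le_max_left _ _) h0
    _ ≤ _ := mul_le_of_le_one_left (le_max_right _ _) (by linarith)

theorem posPartTrace_sum_conj_le {m n ι : Type*} [Fintype m] [DecidableEq m] [Fintype n]
    [DecidableEq n] [Fintype ι] {C : Matrix n n ℂ} (hC : C.IsHermitian) (K : ι → Matrix m n ℂ)
    (hK : ∑ k, (K k)ᴴ * K k = 1) :
    posPartTrace (∑ k, K k * C * (K k)ᴴ) ≤ posPartTrace C := by
  have hT : (∑ k, K k * C * (K k)ᴴ).IsHermitian :=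
    isSelfAdjoint_sum _ fun k _ => isHermitian_mul_mul_conjTranspose (K k) hC
  rw [← re_trace_specProjNonneg_mul hT]
  set P := specProjNonneg (∑ k, K k * C * (K k)ᴴ)
  have hQ : (∑ k, (K k)ᴴ * P * K k).PosSemidef :=
    posSemidef_sum _ fun k _ =>
      (posSemidef_specProjNonneg _).conjTranspose_mul_mul_same (K k)
  have hQ' : (1 - ∑ k, (K k)ᴴ * P * K k).PosSemidef := by
    have h : 1 - ∑ k, (K k)ᴴ * P * K k = ∑ k, (K k)ᴴ * (1 - P) * K k := by
      simp only [Matrix.mul_sub, Matrix.sub_mul, Matrix.mul_one, Finset.sum_sub_distrib, hK]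
    rw [h]
    exact posSemidef_sum _ fun k _ =>
      (posSemidef_one_sub_specProjNonneg _).conjTranspose_mul_mul_same (K k)
  refine le_of_eq_of_le (congrArg Complex.re ?_) (re_trace_mul_le_posPartTrace hC hQ hQ')
  rw [Finset.mul_sum, Finset.sum_mul, trace_sum, trace_sum]
  refine Finset.sum_congr rfl fun k _ => ?_
  rw [← Matrix.mul_assoc, trace_mul_comm]
  simp only [Matrix.mul_assoc]

/-- For Hermitian `A`, `B` and a CPTP map `T(X) = ∑ k, K k * X * (K k)ᴴ`
with `∑ k, (K k)ᴴ * K k = 1`, the trace `Tr[{T(A) − T(B) ≥ 0}(T(A) − T(B))]` is at most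
`Tr[{A − B ≥ 0}(A − B)]`; equivalently the trace of the positive part of `T(A) − T(B)`
is at most that of `A − B`. -/
theorem stmt1 {d d' : ℕ} {ι : Type*} [Fintype ι]
    (A B : Matrix (Fin d) (Fin d) ℂ) (hA : A.IsHermitian) (hB : B.IsHermitian)
    (K : ι → Matrix (Fin d') (Fin d) ℂ)
    (hK : ∑ k, (K k)ᴴ * K k = 1) :
    ((specProjNonneg ((∑ k, K k * A * (K k)ᴴ) - ∑ k, K k * B * (K k)ᴴ) *
          ((∑ k, K k * A * (K k)ᴴ) - ∑ k, K k * B * (K k)ᴴ)).trace).re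
        ≤ ((specProjNonneg (A - B) * (A - B)).trace).re ∧
      posPartTrace ((∑ k, K k * A * (K k)ᴴ) - ∑ k, K k * B * (K k)ᴴ)
        ≤ posPartTrace (A - B) := by
  have hT : (∑ k, K k * A * (K k)ᴴ) - ∑ k, K k * B * (K k)ᴴ = ∑ k, K k * (A - B) * (K k)ᴴ := by
    simp only [Matrix.mul_sub, Matrix.sub_mul, Finset.sum_sub_distrib]
  have hC : (A - B).IsHermitian := hA.sub hB
  have hTC : (∑ k, K k * (A - B) * (K k)ᴴ).IsHermitian :=
    isSelfAdjoint_sum _ fun k _ => isHermitian_mul_mul_conjTranspose (K k) hC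
  rw [hT, re_trace_specProjNonneg_mul hTC, re_trace_specProjNonneg_mul hC]
  exact ⟨posPartTrace_sum_conj_le hC K hK, posPartTrace_sum_conj_le hC K hK⟩

end
end

section
/- Let d_A, d_B, M be positive integers with M ≤ d_A and M ≤ d_B, let |Ψ⁺_M⟩ = (1/√M) ∑_{i=1}^{M} e_i ⊗ e_i be the maximally entangled state of rank M in ℂ^{d_A} ⊗ ℂ^{d_B}, and let σ be a separable density matrix on ℂ^{d_A} ⊗ ℂ^{d_B}, i.e., σ = ∑_k p_k α_k ⊗ β_k for finitely many weights p_k ≥ 0 with ∑_k p_k = 1 and density matrices α_k on ℂ^{d_A} and β_k on ℂ^{d_B}. Then ⟨Ψ⁺_M| σ |Ψ⁺_M⟩ ≤ 1/M. -/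
open Matrix Kronecker ComplexOrder

noncomputable section

/-- Entries of a positive semidefinite matrix are controlled by its diagonal. -/
theorem Matrix.PosSemidef.sq_norm_apply_le {n : Type*} {A : Matrix n n ℂ}
    (hA : A.PosSemidef) (i j : n) : ‖A i j‖ ^ 2 ≤ (A i i).re * (A j j).re := by
  have h := (hA.submatrix ![i, j]).det_nonneg
  rw [Matrix.det_fin_two] at h
  have hii := (Complex.nonneg_iff.1 (hA.diag_nonneg (i := i))).2
  have hjj := (Complex.nonneg_iff.1 (hA.diag_nonneg (i := j))).2
  have hs : A j i = star (A i j) := (hA.isHermitian.apply j i).symm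
  have h' := (Complex.nonneg_iff.1 h).1
  simp [hs, ← hii, ← hjj] at h'
  rw [Complex.sq_norm, Complex.normSq_apply]
  linarith

/-- A family of pairwise distinct diagonal entries of a positive semidefinite matrix sums to at
most the trace. -/
theorem Matrix.PosSemidef.sum_re_diag_le {m n : Type*} [Fintype m] [Fintype n]
    {A : Matrix n n ℂ} (hA : A.PosSemidef) (f : m ↪ n) :
    ∑ i, (A (f i) (f i)).re ≤ A.trace.re := by
  rw [Matrix.trace, Complex.re_sum, ← Finset.sum_map Finset.univ f (fun j => (A j j).re)]
  exact Finset.sum_le_sum_of_subset_of_nonneg (Finset.subset_univ _)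
    fun j _ _ => (Complex.nonneg_iff.1 hA.diag_nonneg).1

/-- A principal submatrix of a positive semidefinite matrix of trace one has Frobenius norm at
most one. -/
theorem Matrix.PosSemidef.sum_sq_norm_le_one {m n : Type*} [Fintype m] [Fintype n]
    {A : Matrix n n ℂ} (hA : A.PosSemidef) (htr : A.trace = 1) (f : m ↪ n) :
    ∑ i, ∑ j, ‖A (f i) (f j)‖ ^ 2 ≤ 1 := by
  have hle := hA.sum_re_diag_le f
  rw [htr, Complex.one_re] at hle
  have h0 : 0 ≤ ∑ i, (A (f i) (f i)).re :=
    Finset.sum_nonneg fun i _ => (Complex.nonneg_iff.1 hA.diag_nonneg).1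
  calc ∑ i, ∑ j, ‖A (f i) (f j)‖ ^ 2
      ≤ ∑ i, ∑ j, (A (f i) (f i)).re * (A (f j) (f j)).re :=
        Finset.sum_le_sum fun i _ => Finset.sum_le_sum fun j _ => hA.sq_norm_apply_le _ _
    _ = (∑ i, (A (f i) (f i)).re) * ∑ j, (A (f j) (f j)).re := by
        rw [Finset.sum_mul_sum]
    _ ≤ 1 := mul_le_one₀ hle h0 hle

/-- The maximally entangled state as a sum of basis vectors. -/
theorem maxEnt_eq_sum {dA dB M : ℕ} (hMA : M ≤ dA) (hMB : M ≤ dB) :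
    maxEnt dA dB M =
      ∑ i : Fin M, Pi.single (Fin.castLE hMA i, Fin.castLE hMB i) ((Real.sqrt M : ℂ))⁻¹ := by
  funext ⟨a, b⟩
  rw [Finset.sum_apply, maxEnt]
  split_ifs with h
  · obtain ⟨hab, ha⟩ := h
    rw [Finset.sum_eq_single ⟨a, ha⟩]
    · have : ((a, b) : Fin dA × Fin dB) =
          (Fin.castLE hMA ⟨a, ha⟩, Fin.castLE hMB ⟨a, ha⟩) := by
        ext <;> simp_all
      rw [this, Pi.single_eq_same]
    · intro i _ hi
      refine Pi.single_eq_of_ne (fun he => hi ?_) _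
      have := congrArg (fun q => (q.1 : ℕ)) he
      ext
      simpa using this.symm
    · simp
  · refine (Finset.sum_eq_zero fun i _ => Pi.single_eq_of_ne (fun he => h ?_) _).symm
    obtain ⟨rfl, rfl⟩ := Prod.mk.inj he
    simp

theorem overlap_maxEnt {dA dB M : ℕ} (hMA : M ≤ dA) (hMB : M ≤ dB)
    (X : Matrix (Fin dA × Fin dB) (Fin dA × Fin dB) ℂ) :
    overlap (maxEnt dA dB M) X = (M : ℂ)⁻¹ * ∑ i : Fin M, ∑ j : Fin M,
      X (Fin.castLE hMA i, Fin.castLE hMB i) (Fin.castLE hMA j, Fin.castLE hMB j) := by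
  have hc : ((Real.sqrt M : ℂ))⁻¹ * ((Real.sqrt M : ℂ))⁻¹ = (M : ℂ)⁻¹ := by
    rw [← mul_inv, ← Complex.ofReal_mul, Real.mul_self_sqrt (Nat.cast_nonneg M),
      Complex.ofReal_natCast]
  rw [overlap, maxEnt_eq_sum hMA hMB, star_sum, sum_dotProduct, Finset.mul_sum]
  refine Finset.sum_congr rfl fun i _ => ?_
  rw [mulVec_sum, dotProduct_sum, Finset.mul_sum]
  refine Finset.sum_congr rfl fun j _ => ?_
  rw [← Pi.single_star, single_dotProduct, mulVec_single, ← hc]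
  simp
  ring

/-- The overlap of a product state with the maximally entangled state is at most `1 / M`. -/
theorem overlap_maxEnt_kronecker_le {dA dB M : ℕ} (hMA : M ≤ dA) (hMB : M ≤ dB)
    {A : Matrix (Fin dA) (Fin dA) ℂ} {B : Matrix (Fin dB) (Fin dB) ℂ}
    (hA : A.PosSemidef) (hAtr : A.trace = 1) (hB : B.PosSemidef) (hBtr : B.trace = 1) :
    (overlap (maxEnt dA dB M) (A ⊗ₖ B)).re ≤ 1 / M := by
  have hA1 := hA.sum_sq_norm_le_one hAtr (Fin.castLEEmb hMA)
  have hB1 := hB.sum_sq_norm_le_one hBtr (Fin.castLEEmb hMB)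
  have key : (∑ i : Fin M, ∑ j : Fin M, A (Fin.castLE hMA i) (Fin.castLE hMA j) *
      B (Fin.castLE hMB i) (Fin.castLE hMB j)).re ≤ 1 := by
    simp only [Complex.re_sum]
    calc _ ≤ ∑ i : Fin M, ∑ j : Fin M, (‖A (Fin.castLE hMA i) (Fin.castLE hMA j)‖ ^ 2 +
          ‖B (Fin.castLE hMB i) (Fin.castLE hMB j)‖ ^ 2) / 2 := by
          refine Finset.sum_le_sum fun i _ => Finset.sum_le_sum fun j _ => ?_
          refine (Complex.re_le_norm _).trans ?_
          rw [norm_mul]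
          linarith [two_mul_le_add_sq ‖A (Fin.castLE hMA i) (Fin.castLE hMA j)‖
            ‖B (Fin.castLE hMB i) (Fin.castLE hMB j)‖]
      _ ≤ 1 := by
          simp only [← Finset.sum_div, Finset.sum_add_distrib]
          change ∑ i : Fin M, ∑ j : Fin M,
            ‖A (Fin.castLE hMA i) (Fin.castLE hMA j)‖ ^ 2 ≤ 1 at hA1
          change ∑ i : Fin M, ∑ j : Fin M,
            ‖B (Fin.castLE hMB i) (Fin.castLE hMB j)‖ ^ 2 ≤ 1 at hB1
          linarith
  rw [overlap_maxEnt hMA hMB, ← Complex.ofReal_natCast, ← Complex.ofReal_inv,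
    Complex.re_ofReal_mul, one_div]
  exact mul_le_of_le_one_right (by positivity) key

/-- For a separable density matrix
`σ = ∑ k, p k • (α k ⊗ β k)` on `ℂ^dA ⊗ ℂ^dB`, the overlap with the rank-`M`
maximally entangled state satisfies `⟨Ψ⁺_M| σ |Ψ⁺_M⟩ ≤ 1/M`. -/
theorem stmt5 {dA dB M : ℕ} (hM : 0 < M) (hMA : M ≤ dA) (hMB : M ≤ dB)
    {ι : Type*} [Fintype ι] (p : ι → ℝ) (hp : ∀ k, 0 ≤ p k) (hp1 : ∑ k, p k = 1)
    (α : ι → Matrix (Fin dA) (Fin dA) ℂ) (β : ι → Matrix (Fin dB) (Fin dB) ℂ)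
    (hα : ∀ k, (α k).PosSemidef) (hαtr : ∀ k, (α k).trace = 1)
    (hβ : ∀ k, (β k).PosSemidef) (hβtr : ∀ k, (β k).trace = 1)
    (σ : Matrix (Fin dA × Fin dB) (Fin dA × Fin dB) ℂ)
    (hσ : σ = ∑ k, (p k : ℂ) • (α k ⊗ₖ β k)) :
    (overlap (maxEnt dA dB M) σ).re ≤ 1 / M := by
  have hlin : overlap (maxEnt dA dB M) σ =
      ∑ k, (p k : ℂ) * overlap (maxEnt dA dB M) (α k ⊗ₖ β k) := by
    simp only [hσ, overlap, sum_mulVec, dotProduct_sum, smul_mulVec, dotProduct_smul, smul_eq_mul]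
  rw [hlin, Complex.re_sum]
  calc ∑ k, ((p k : ℂ) * overlap (maxEnt dA dB M) (α k ⊗ₖ β k)).re
      ≤ ∑ k, p k * (1 / M) := by
        refine Finset.sum_le_sum fun k _ => ?_
        rw [Complex.re_ofReal_mul]
        exact mul_le_mul_of_nonneg_left
          (overlap_maxEnt_kronecker_le hMA hMB (hα k) (hαtr k) (hβ k) (hβtr k)) (hp k)
    _ = 1 / M := by rw [← Finset.sum_mul, hp1, one_mul]

end
end

section
/- Let ω be a density matrix on ℂ^{d_A} ⊗ ℂ^{d_B}, let ω^B denote its partial trace over the first factor, i.e., the d_B×d_B matrix with entries (ω^B)_{j j'} = ∑_{i=1}^{d_A} ω_{(i,j),(i,j')}, let M be a positive integer with M ≤ d_A and M ≤ d_B, and let γ be a real number. Then the overlap of ω with the maximally entangled state of rank M satisfies ⟨Ψ⁺_M| ω |Ψ⁺_M⟩ ≤ Tr[(ω − e^{γ} I_{d_A} ⊗ ω^B)⁺] + e^{γ}/M, where (·)⁺ denotes the positive part of a Hermitian matrix. -/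
open Matrix Kronecker ComplexOrder

noncomputable section

/-- The partial trace over the first tensor factor: `(ω^B)_{j j'} = ∑ i, ω_{(i,j),(i,j')}`. -/
def ptraceA {dA dB : ℕ} (ω : Matrix (Fin dA × Fin dB) (Fin dA × Fin dB) ℂ) :
    Matrix (Fin dB) (Fin dB) ℂ :=
  Matrix.of fun j j' => ∑ i : Fin dA, ω (i, j) (i, j')

/-- The quadratic form of a Hermitian matrix at a subnormalized vector is at most the trace of
its positive part. -/
theorem overlap_re_le_posPartTrace {n : Type*} [Fintype n] [DecidableEq n] {C : Matrix n n ℂ}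
    (hC : C.IsHermitian) {ψ : n → ℂ} (hψ : (star ψ ⬝ᵥ ψ).re ≤ 1) :
    (overlap ψ C).re ≤ posPartTrace C := by
  set U : Matrix n n ℂ := ↑hC.eigenvectorUnitary
  set φ : n → ℂ := star U *ᵥ ψ with hφ
  have hstar : star φ = star ψ ᵥ* U := by
    rw [hφ, star_mulVec, star_eq_conjTranspose, conjTranspose_conjTranspose]
  have hUU : U * star U = 1 := Unitary.coe_mul_star_self hC.eigenvectorUnitary
  have hnorm : star φ ⬝ᵥ φ = star ψ ⬝ᵥ ψ := by
    rw [hstar, hφ, ← dotProduct_mulVec, mulVec_mulVec, hUU, one_mulVec]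
  have hspec : C = U * diagonal (fun i => (hC.eigenvalues i : ℂ)) * star U := by
    have h := hC.spectral_theorem
    rw [Unitary.conjStarAlgAut_apply] at h
    exact h
  have hover : overlap ψ C = ∑ i, (hC.eigenvalues i : ℂ) * Complex.normSq (φ i) := by
    have h : overlap ψ C = star φ ⬝ᵥ diagonal (fun i => (hC.eigenvalues i : ℂ)) *ᵥ φ := by
      rw [hstar, hφ, ← dotProduct_mulVec, mulVec_mulVec, mulVec_mulVec,
        ← hspec, overlap]
    rw [h]
    simp only [dotProduct, mulVec_diagonal, Pi.star_apply, RCLike.star_def,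
      Complex.normSq_eq_conj_mul_self]
    exact Finset.sum_congr rfl fun i _ => by ring
  have hsum : ∑ i, Complex.normSq (φ i) ≤ 1 := by
    rw [← hnorm] at hψ
    simpa [dotProduct, ← Complex.normSq_eq_conj_mul_self] using hψ
  rw [posPartTrace, dif_pos hC, hover, Complex.re_sum]
  refine Finset.sum_le_sum fun i _ => ?_
  have hi : Complex.normSq (φ i) ≤ 1 :=
    (Finset.single_le_sum (fun j _ => Complex.normSq_nonneg (φ j)) (Finset.mem_univ i)).trans hsum
  rw [← Complex.ofReal_mul, Complex.ofReal_re]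
  calc hC.eigenvalues i * Complex.normSq (φ i)
      ≤ max (hC.eigenvalues i) 0 * Complex.normSq (φ i) :=
        mul_le_mul_of_nonneg_right (le_max_left _ _) (Complex.normSq_nonneg _)
    _ ≤ max (hC.eigenvalues i) 0 := mul_le_of_le_one_right (le_max_right _ _) hi

theorem star_maxEnt (dA dB M : ℕ) : star (maxEnt dA dB M) = maxEnt dA dB M := by
  ext p
  simp only [maxEnt, Pi.star_apply]
  split_ifs <;> simp

/-- Pairing with the maximally entangled state sums over the diagonal pairs `(i, i)`, `i < M`. -/
theorem maxEnt_dotProduct {dA dB M : ℕ} (hMA : M ≤ dA) (hMB : M ≤ dB)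
    (f : Fin dA × Fin dB → ℂ) :
    maxEnt dA dB M ⬝ᵥ f =
      (Real.sqrt M : ℂ)⁻¹ * ∑ i : Fin M, f (Fin.castLE hMA i, Fin.castLE hMB i) := by
  rw [Finset.mul_sum, dotProduct]
  symm
  refine Finset.sum_of_injOn (fun i : Fin M => (Fin.castLE hMA i, Fin.castLE hMB i)) ?_ ?_ ?_ ?_
  · intro i _ j _ h
    exact Fin.castLE_injective hMA (Prod.ext_iff.mp h).1
  · simp
  · rintro ⟨a, b⟩ _ h
    have h' : ¬((a : ℕ) = (b : ℕ) ∧ (a : ℕ) < M) := by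
      rintro ⟨hab, ha⟩
      exact h ⟨⟨a, ha⟩, by simp, by ext <;> simp [hab]⟩
    simp [maxEnt, h']
  · intro i _
    simp [maxEnt]

theorem inv_sqrt_mul_inv_sqrt (M : ℕ) :
    (Real.sqrt M : ℂ)⁻¹ * (Real.sqrt M : ℂ)⁻¹ = (M : ℂ)⁻¹ := by
  rw [← mul_inv, ← Complex.ofReal_mul, Real.mul_self_sqrt M.cast_nonneg, Complex.ofReal_natCast]

theorem star_maxEnt_dotProduct_self {dA dB M : ℕ} (hM : 0 < M) (hMA : M ≤ dA) (hMB : M ≤ dB) :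
    star (maxEnt dA dB M) ⬝ᵥ maxEnt dA dB M = 1 := by
  have hM' : (M : ℂ) ≠ 0 := Nat.cast_ne_zero.mpr hM.ne'
  rw [star_maxEnt, maxEnt_dotProduct hMA hMB]
  simp only [maxEnt, Fin.val_castLE, Fin.is_lt, and_self, if_true, Finset.sum_const,
    Finset.card_univ, Fintype.card_fin, nsmul_eq_mul]
  rw [mul_left_comm, inv_sqrt_mul_inv_sqrt, mul_inv_cancel₀ hM']

/-- The overlap of `I ⊗ ρ` with the maximally entangled state. -/
theorem overlap_maxEnt_one_kronecker {dA dB M : ℕ} (hMA : M ≤ dA) (hMB : M ≤ dB)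
    (ρ : Matrix (Fin dB) (Fin dB) ℂ) :
    overlap (maxEnt dA dB M) ((1 : Matrix (Fin dA) (Fin dA) ℂ) ⊗ₖ ρ) =
      (M : ℂ)⁻¹ * ∑ i : Fin M, ρ (Fin.castLE hMB i) (Fin.castLE hMB i) := by
  rw [overlap, star_maxEnt, maxEnt_dotProduct hMA hMB]
  simp only [mulVec, dotProduct_comm _ (maxEnt dA dB M), maxEnt_dotProduct hMA hMB,
    kroneckerMap_apply, one_apply, (Fin.castLE_injective hMA).eq_iff, ite_mul, one_mul, zero_mul,
    Finset.sum_ite_eq, Finset.mem_univ, if_true]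
  rw [← Finset.mul_sum, ← mul_assoc, inv_sqrt_mul_inv_sqrt]

theorem isHermitian_ptraceA {dA dB : ℕ} {ω : Matrix (Fin dA × Fin dB) (Fin dA × Fin dB) ℂ}
    (hω : ω.IsHermitian) : (ptraceA ω).IsHermitian := by
  ext i j
  simp only [ptraceA, conjTranspose_apply, of_apply, star_sum]
  exact Finset.sum_congr rfl fun k _ => hω.apply _ _

theorem trace_ptraceA {dA dB : ℕ} (ω : Matrix (Fin dA × Fin dB) (Fin dA × Fin dB) ℂ) :
    (ptraceA ω).trace = ω.trace := by
  simp only [trace, diag_apply, ptraceA, of_apply, Fintype.sum_prod_type]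
  exact Finset.sum_comm

theorem ptraceA_diag_nonneg {dA dB : ℕ} {ω : Matrix (Fin dA × Fin dB) (Fin dA × Fin dB) ℂ}
    (hω : ω.PosSemidef) (j : Fin dB) : 0 ≤ ptraceA ω j j := by
  rw [ptraceA, of_apply]
  exact Finset.sum_nonneg fun _ _ => hω.diag_nonneg

theorem overlap_maxEnt_one_kronecker_ptraceA_le {dA dB M : ℕ} (hMA : M ≤ dA) (hMB : M ≤ dB)
    {ω : Matrix (Fin dA × Fin dB) (Fin dA × Fin dB) ℂ} (hω : ω.PosSemidef) (hωtr : ω.trace = 1) :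
    overlap (maxEnt dA dB M) ((1 : Matrix (Fin dA) (Fin dA) ℂ) ⊗ₖ ptraceA ω) ≤ (M : ℂ)⁻¹ := by
  rw [overlap_maxEnt_one_kronecker hMA hMB]
  have hsum : ∑ i : Fin M, ptraceA ω (Fin.castLE hMB i) (Fin.castLE hMB i) ≤ 1 := by
    rw [← hωtr, ← trace_ptraceA]
    have h := Finset.sum_le_univ_sum_of_nonneg (s := Finset.univ.map (Fin.castLEEmb hMB))
      (ptraceA_diag_nonneg hω)
    rwa [Finset.sum_map] at h
  have hinv : (0 : ℂ) ≤ (M : ℂ)⁻¹ := by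
    rw [← Complex.ofReal_natCast, ← Complex.ofReal_inv]
    exact Complex.zero_le_real.mpr (by positivity)
  exact mul_le_of_le_one_right hinv hsum

/-- For a density matrix `ω` on `ℂ^dA ⊗ ℂ^dB`, `M ≤ dA`, `M ≤ dB`
and `γ : ℝ`, `⟨Ψ⁺_M| ω |Ψ⁺_M⟩ ≤ Tr[(ω − e^γ I ⊗ ω^B)⁺] + e^γ / M`. -/
theorem stmt6 {dA dB M : ℕ} (hM : 0 < M) (hMA : M ≤ dA) (hMB : M ≤ dB)
    (ω : Matrix (Fin dA × Fin dB) (Fin dA × Fin dB) ℂ)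
    (hω : ω.PosSemidef) (hωtr : ω.trace = 1) (γ : ℝ) :
    (overlap (maxEnt dA dB M) ω).re
      ≤ posPartTrace
          (ω - (Real.exp γ : ℂ) • ((1 : Matrix (Fin dA) (Fin dA) ℂ) ⊗ₖ ptraceA ω))
        + Real.exp γ / M := by
  set K := (1 : Matrix (Fin dA) (Fin dA) ℂ) ⊗ₖ ptraceA ω with hK
  have hKherm : K.IsHermitian := by
    rw [IsHermitian, hK, conjTranspose_kronecker, conjTranspose_one,
      (isHermitian_ptraceA hω.isHermitian).eq]
  have hC : (ω - (Real.exp γ : ℂ) • K).IsHermitian := by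
    rw [IsHermitian, conjTranspose_sub, conjTranspose_smul, hω.isHermitian.eq, hKherm.eq,
      RCLike.star_def, Complex.conj_ofReal]
  have hpos := overlap_re_le_posPartTrace hC
    (ψ := maxEnt dA dB M) (by simp [star_maxEnt_dotProduct_self hM hMA hMB])
  have hre : (overlap (maxEnt dA dB M) K).re ≤ (M : ℝ)⁻¹ := by
    have h := (Complex.le_def.mp (overlap_maxEnt_one_kronecker_ptraceA_le hMA hMB hω hωtr)).1
    rwa [← Complex.ofReal_natCast, ← Complex.ofReal_inv, Complex.ofReal_re] at h
  have hsub : (overlap (maxEnt dA dB M) (ω - (Real.exp γ : ℂ) • K)).re =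
      (overlap (maxEnt dA dB M) ω).re - Real.exp γ * (overlap (maxEnt dA dB M) K).re := by
    simp only [overlap]
    rw [sub_mulVec, dotProduct_sub, smul_mulVec, dotProduct_smul, smul_eq_mul, Complex.sub_re,
      Complex.re_ofReal_mul]
  have hmul := mul_le_mul_of_nonneg_left hre (Real.exp_pos γ).le
  rw [div_eq_mul_inv]
  linarith

end
end
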